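/- arXiv:2301.06318 — 3 statements merged into one kernel-verified Lean document; each statement's English description precedes it below -/
import Mathlib

section
/- Let μ be the uniform probability measure on [−1,1]³ ⊂ ℝ³ (i.e., (1/8) times Lebesgue measure restricted to [−1,1]³). Define w(a,b) := |a| + |b| + |a − b|, and set A := {(a,b,c) ∈ [−1,1]³ : w(a,b) > 3 and w(b,c) > 4 − √2} and B := {(a,b,c) ∈ [−1,1]³ : w(a,c) > 3}. Then μ(A) > 0, μ(B) > 0, and A ∩ B = ∅; in particular μ(A ∩ B) = 0 < μ(A)·μ(B), so the decreasing events A and B are not positively correlated (the FKG inequality fails). -/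
open MeasureTheory
open scoped ENNReal

/-- A subset of `box` containing a nonempty open set has positive measure under any nonzero
multiple of the restriction of an open-positive measure to `box`. -/
theorem smul_restrict_pos_of_isOpen_subset {X : Type*} [TopologicalSpace X] [MeasurableSpace X]
    (ν : Measure X) [ν.IsOpenPosMeasure] {c : ℝ≥0∞} (hc : c ≠ 0) {box S U : Set X}
    (hS : S ⊆ box) (hU : IsOpen U) (hne : U.Nonempty) (hUS : U ⊆ S) :
    0 < (c • ν.restrict box) S := by
  rw [Measure.smul_apply, Measure.restrict_eq_self _ hS, smul_eq_mul]
  exact ENNReal.mul_pos hc ((hU.measure_pos ν hne).trans_le (measure_mono hUS)).ne'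

/-- Two points of `[-1,1]` with `|a| + |b| + |a - b| > 3` have opposite signs. -/
theorem opposite_signs_of_three_lt {a b : ℝ} (ha : a ∈ Set.Icc (-1 : ℝ) 1)
    (hb : b ∈ Set.Icc (-1 : ℝ) 1) (h : |a| + |b| + |a - b| > 3) :
    (0 < a ∧ b < 0) ∨ (a < 0 ∧ 0 < b) := by
  obtain ⟨ha₁, ha₂⟩ := ha
  obtain ⟨hb₁, hb₂⟩ := hb
  grind

/-- Two points of `[-1,1]` of the same strict sign satisfy `|a| + |b| + |a - b| ≤ 2`. -/
theorem abs_add_abs_add_abs_sub_le_two {a b : ℝ} (ha : a ∈ Set.Icc (-1 : ℝ) 1)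
    (hb : b ∈ Set.Icc (-1 : ℝ) 1) (h : (0 < a ∧ 0 < b) ∨ (a < 0 ∧ b < 0)) :
    |a| + |b| + |a - b| ≤ 2 := by
  obtain ⟨ha₁, ha₂⟩ := ha
  obtain ⟨hb₁, hb₂⟩ := hb
  grind

/-- If `3/4 < |a|, |b|` with opposite signs then `|a| + |b| + |a - b| > 3`. -/
theorem three_lt_of_pos_of_neg {a b : ℝ} (ha : 3 / 4 < a) (hb : b < -(3 / 4)) :
    |a| + |b| + |a - b| > 3 := by
  grind

/-- Failure of the FKG inequality in the toy model of Appendix B: with `μ` the uniform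
probability measure on `[-1,1]³` and `w a b = |a| + |b| + |a - b|`, the events
`A = {w(a,b) > 3 and w(b,c) > 4 - √2}` and `B = {w(a,c) > 3}` satisfy `μ A > 0`,
`μ B > 0`, `A ∩ B = ∅`, hence `μ (A ∩ B) = 0 < μ A * μ B`. -/
theorem fkg_failure_toy_model :
    let w : ℝ → ℝ → ℝ := fun a b => |a| + |b| + |a - b|
    let box : Set (ℝ × ℝ × ℝ) :=
      Set.Icc (-1 : ℝ) 1 ×ˢ Set.Icc (-1 : ℝ) 1 ×ˢ Set.Icc (-1 : ℝ) 1
    let μ : Measure (ℝ × ℝ × ℝ) := (8 : ℝ≥0∞)⁻¹ • (volume.restrict box)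
    let A : Set (ℝ × ℝ × ℝ) :=
      {p | p ∈ box ∧ w p.1 p.2.1 > 3 ∧ w p.2.1 p.2.2 > 4 - Real.sqrt 2}
    let B : Set (ℝ × ℝ × ℝ) := {p | p ∈ box ∧ w p.1 p.2.2 > 3}
    0 < μ A ∧ 0 < μ B ∧ A ∩ B = ∅ ∧ μ (A ∩ B) = 0 ∧ μ (A ∩ B) < μ A * μ B := by
  intro w box μ A B
  have hA : 0 < μ A := by
    refine smul_restrict_pos_of_isOpen_subset volume (by simp) (fun p hp => hp.1)
      (U := Set.Ioo (3 / 4 : ℝ) 1 ×ˢ Set.Ioo (-1 : ℝ) (-(3 / 4)) ×ˢ Set.Ioo (3 / 4 : ℝ) 1)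
      (isOpen_Ioo.prod (isOpen_Ioo.prod isOpen_Ioo))
      ⟨(7 / 8, -(7 / 8), 7 / 8), by norm_num⟩ ?_
    rintro ⟨a, b, c⟩ ⟨⟨ha₁, ha₂⟩, ⟨hb₁, hb₂⟩, hc₁, hc₂⟩
    dsimp only at ha₁ ha₂ hb₁ hb₂ hc₁ hc₂
    refine ⟨⟨⟨by linarith, ha₂.le⟩, ⟨hb₁.le, by linarith⟩, by linarith, hc₂.le⟩,
      three_lt_of_pos_of_neg ha₁ hb₂, ?_⟩
    have hcb := three_lt_of_pos_of_neg hc₁ hb₂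
    have hsqrt : 1 ≤ Real.sqrt 2 := Real.one_le_sqrt.2 (by norm_num)
    change |b| + |c| + |b - c| > 4 - Real.sqrt 2
    rw [abs_sub_comm b c]
    linarith
  have hB : 0 < μ B := by
    refine smul_restrict_pos_of_isOpen_subset volume (by simp) (fun p hp => hp.1)
      (U := Set.Ioo (3 / 4 : ℝ) 1 ×ˢ Set.Ioo (-1 : ℝ) 1 ×ˢ Set.Ioo (-1 : ℝ) (-(3 / 4)))
      (isOpen_Ioo.prod (isOpen_Ioo.prod isOpen_Ioo))
      ⟨(7 / 8, 0, -(7 / 8)), by norm_num⟩ ?_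
    rintro ⟨a, b, c⟩ ⟨⟨ha₁, ha₂⟩, ⟨hb₁, hb₂⟩, hc₁, hc₂⟩
    dsimp only at ha₁ ha₂ hb₁ hb₂ hc₁ hc₂
    exact ⟨⟨⟨by linarith, ha₂.le⟩, ⟨hb₁.le, hb₂.le⟩, hc₁.le, by linarith⟩,
      three_lt_of_pos_of_neg ha₁ hc₂⟩
  have hAB : A ∩ B = ∅ := by
    refine Set.eq_empty_iff_forall_notMem.2 ?_
    rintro ⟨a, b, c⟩ ⟨⟨⟨ha, hb, hc⟩, hab, hbc⟩, -, hac⟩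
    have hsigns : (0 < b ∧ 0 < c) ∨ (b < 0 ∧ c < 0) := by
      rcases opposite_signs_of_three_lt ha hb hab with h | h <;>
        rcases opposite_signs_of_three_lt ha hc hac with h' | h' <;> grind
    have hle := abs_add_abs_add_abs_sub_le_two hb hc hsigns
    have hsqrt : Real.sqrt 2 ≤ 2 := Real.sqrt_le_iff.2 (by norm_num)
    change |b| + |c| + |b - c| > 4 - Real.sqrt 2 at hbc
    dsimp only at hle
    linarith
  have hzero : μ (A ∩ B) = 0 := by rw [hAB, measure_empty]
  exact ⟨hA, hB, hAB, hzero, hzero.trans_lt (ENNReal.mul_pos hA.ne' hB.ne')⟩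
end

section
/- Let G be a simple graph on a finite vertex set V and let u : V → ℝ. Let p₁, …, p_n be paths in G (walks with pairwise distinct vertices) whose vertex sets are pairwise disjoint, and suppose that for each i the initial vertex a_i of p_i satisfies u(a_i) = 1 and the final vertex b_i satisfies u(b_i) = 0. Then ∑_{{x,y} ∈ E(G)} (u(y) − u(x))² ≥ ∑_{i=1}^n 1/|p_i| ≥ n² / (∑_{i=1}^n |p_i|), where |p_i| denotes the number of vertices of p_i and the first sum ranges over the edge set of G (one term per edge). -/
/-- The squared increment of `u` across an unordered pair of vertices. -/
def sqIncrement {V : Type*} (u : V → ℝ) : Sym2 V → ℝ :=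
  Sym2.lift ⟨fun x y => (u y - u x) ^ 2, fun x y => by ring⟩

theorem sqIncrement_nonneg {V : Type*} (u : V → ℝ) (e : Sym2 V) : 0 ≤ sqIncrement u e := by
  induction e with
  | h x y => exact sq_nonneg (u y - u x)

/-- The energy of `u` along a walk dominates every supporting line of the parabola
`x ↦ x ^ 2 / p.length` at the total decrement of `u`: the Cauchy–Schwarz bound in linear form. -/
theorem SimpleGraph.Walk.linear_le_sum_sqIncrement {V : Type*} {G : SimpleGraph V} (u : V → ℝ)
    (t : ℝ) {a b : V} (p : G.Walk a b) :
    2 * t * (u a - u b) - t ^ 2 * p.length ≤ (p.edges.map (sqIncrement u)).sum := by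
  induction p with
  | nil => simp
  | @cons x y z h p ih =>
    have hxy : sqIncrement u s(x, y) = (u y - u x) ^ 2 := rfl
    simp only [SimpleGraph.Walk.edges_cons, List.map_cons, List.sum_cons, hxy,
      SimpleGraph.Walk.length_cons, Nat.cast_add, Nat.cast_one]
    linarith [sq_nonneg (u x - u y - t)]

/-- A path along which `u` drops from `1` to `0` carries energy at least the inverse of its
number of vertices. -/
theorem SimpleGraph.Walk.IsPath.one_div_le_sum_sqIncrement {V : Type*} [DecidableEq V]
    {G : SimpleGraph V} {u : V → ℝ} {a b : V} {p : G.Walk a b} (hp : p.IsPath)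
    (ha : u a = 1) (hb : u b = 0) :
    1 / (p.support.length : ℝ) ≤ ∑ e ∈ p.edges.toFinset, sqIncrement u e := by
  rw [List.sum_toFinset _ hp.isTrail.edges_nodup]
  refine le_trans ?_ (p.linear_le_sum_sqIncrement u (1 / (p.support.length : ℝ)))
  rw [ha, hb, SimpleGraph.Walk.length_support]
  have hpos : (0 : ℝ) < p.length + 1 := by positivity
  push_cast
  rw [← sub_nonneg]
  have : 2 * (1 / ((p.length : ℝ) + 1)) * (1 - 0) - (1 / ((p.length : ℝ) + 1)) ^ 2 * p.length
      - 1 / ((p.length : ℝ) + 1) = (1 / ((p.length : ℝ) + 1)) ^ 2 := by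
    field_simp
    ring
  rw [this]
  positivity

theorem SimpleGraph.Walk.disjoint_edges_of_disjoint_support {V : Type*} {G : SimpleGraph V}
    {a b c d : V} {p : G.Walk a b} {q : G.Walk c d} (h : List.Disjoint p.support q.support) :
    List.Disjoint p.edges q.edges := by
  intro e hp hq
  induction e with
  | h x y => exact h (p.fst_mem_support_of_mem_edges hp) (q.fst_mem_support_of_mem_edges hq)


/-- Combinatorial core of Lemma 10.1: if `p₁, …, pₙ` are vertex-disjoint paths in a
finite simple graph `G` and `u` takes value `1` at the initial vertex and `0` at the
final vertex of each path, then
`∑_{e ∈ E(G)} (u(y) - u(x))² ≥ ∑ᵢ 1/|pᵢ| ≥ n² / ∑ᵢ |pᵢ|`, where `|pᵢ|` is the number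
of vertices of `pᵢ`. -/
theorem dirichlet_lower_bound_paths {V : Type*} [Fintype V] [DecidableEq V]
    (G : SimpleGraph V) [DecidableRel G.Adj] (u : V → ℝ) (n : ℕ)
    (a b : Fin n → V) (p : ∀ i : Fin n, G.Walk (a i) (b i))
    (hpath : ∀ i, (p i).IsPath)
    (hdisj : ∀ i j, i ≠ j → List.Disjoint (p i).support (p j).support)
    (ha : ∀ i, u (a i) = 1) (hb : ∀ i, u (b i) = 0) :
    (∑ e ∈ G.edgeFinset,
        Sym2.lift ⟨fun x y => (u y - u x) ^ 2, fun x y => by ring⟩ e)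
      ≥ ∑ i : Fin n, (1 : ℝ) / ((p i).support.length : ℝ) ∧
    (∑ i : Fin n, (1 : ℝ) / ((p i).support.length : ℝ))
      ≥ (n : ℝ) ^ 2 / (∑ i : Fin n, ((p i).support.length : ℝ)) := by
  constructor
  · change ∑ i : Fin n, (1 : ℝ) / ((p i).support.length : ℝ) ≤
      ∑ e ∈ G.edgeFinset, sqIncrement u e
    have hedges : (Set.univ : Set (Fin n)).PairwiseDisjoint fun i => (p i).edges.toFinset :=
      fun i _ j _ hij => List.disjoint_toFinset_iff_disjoint.mpr
        (SimpleGraph.Walk.disjoint_edges_of_disjoint_support (hdisj i j hij))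
    calc ∑ i : Fin n, (1 : ℝ) / ((p i).support.length : ℝ)
        ≤ ∑ i : Fin n, ∑ e ∈ (p i).edges.toFinset, sqIncrement u e :=
          Finset.sum_le_sum fun i _ => (hpath i).one_div_le_sum_sqIncrement (ha i) (hb i)
      _ = ∑ e ∈ Finset.univ.biUnion fun i => (p i).edges.toFinset, sqIncrement u e :=
          (Finset.sum_biUnion (by simpa using hedges)).symm
      _ ≤ ∑ e ∈ G.edgeFinset, sqIncrement u e := by
          refine Finset.sum_le_sum_of_subset_of_nonneg ?_ fun e _ _ => sqIncrement_nonneg u e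
          intro e he
          simp only [Finset.mem_biUnion, Finset.mem_univ, true_and, List.mem_toFinset] at he
          obtain ⟨i, hi⟩ := he
          exact SimpleGraph.mem_edgeFinset.mpr ((p i).edges_subset_edgeSet hi)
  · have hpos : ∀ i ∈ Finset.univ, (0 : ℝ) < ((p i).support.length : ℝ) := fun i _ => by
      rw [SimpleGraph.Walk.length_support]
      positivity
    simpa using Finset.sq_sum_div_le_sum_sq_div Finset.univ (fun _ => (1 : ℝ)) hpos
end

section
/- Let d ≥ 1 and ℓ > 0, with S_ℓ := ℝ × (−ℓ/2, ℓ/2)^{d−1} ⊂ ℝ^d, Λ_ℓ := (−ℓ/2, ℓ/2)^d, S_ℓ⁻ := {x ∈ S_ℓ : x₁ ≤ −ℓ/2} and S_ℓ⁺ := {x ∈ S_ℓ : x₁ ≥ ℓ/2}. Let G = (V, E) be a graph with V ⊂ ℝ^d such that V ∩ Λ_ℓ is finite, and suppose there exist n pairwise vertex-disjoint LR crossings of Λ_ℓ in G. Then σ_ℓ(G, 1) ≥ n² / (2n + |V ∩ Λ_ℓ|) ≥ n² / (3·|V ∩ Λ_ℓ|), where σ_ℓ(G, 1) is the ℓ-conductivity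 with all edge weights equal to 1. -/
open scoped Classical

/-- The stripe `S_ℓ = ℝ × (-ℓ/2, ℓ/2)^{d-1}`. -/
def inStripe (d : ℕ) (ℓ : ℝ) (x : EuclideanSpace ℝ (Fin d)) : Prop :=
  ∀ i : Fin d, i.val ≠ 0 → x i ∈ Set.Ioo (-ℓ / 2) (ℓ / 2)

/-- The box `Λ_ℓ = (-ℓ/2, ℓ/2)^d`. -/
def inBox (d : ℕ) (ℓ : ℝ) (x : EuclideanSpace ℝ (Fin d)) : Prop :=
  ∀ i : Fin d, x i ∈ Set.Ioo (-ℓ / 2) (ℓ / 2)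

/-- The left part `S_ℓ⁻ = {x ∈ S_ℓ : x₁ ≤ -ℓ/2}`. -/
def inLeft (d : ℕ) (ℓ : ℝ) (x : EuclideanSpace ℝ (Fin d)) : Prop :=
  inStripe d ℓ x ∧ ∀ i : Fin d, i.val = 0 → x i ≤ -ℓ / 2

/-- The right part `S_ℓ⁺ = {x ∈ S_ℓ : x₁ ≥ ℓ/2}`. -/
def inRight (d : ℕ) (ℓ : ℝ) (x : EuclideanSpace ℝ (Fin d)) : Prop :=
  inStripe d ℓ x ∧ ∀ i : Fin d, i.val = 0 → ℓ / 2 ≤ x i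

/-- The Dirichlet sum `∑ C(x,y) (u(y)-u(x))²`, one term per edge `{x,y}` of the graph
`(V, Adj)` with one endpoint in `V ∩ Λ_ℓ` and the other in `V ∩ S_ℓ` (the double sum
over ordered pairs is halved). -/
noncomputable def dirichletSum (d : ℕ) (ℓ : ℝ) (V : Finset (EuclideanSpace ℝ (Fin d)))
    (Adj : EuclideanSpace ℝ (Fin d) → EuclideanSpace ℝ (Fin d) → Prop)
    (C : EuclideanSpace ℝ (Fin d) → EuclideanSpace ℝ (Fin d) → ℝ)
    (u : EuclideanSpace ℝ (Fin d) → ℝ) : ℝ :=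
  (1 / 2) * ∑ x ∈ V, ∑ y ∈ V,
    if x ≠ y ∧ Adj x y ∧
        ((inBox d ℓ x ∧ inStripe d ℓ y) ∨ (inBox d ℓ y ∧ inStripe d ℓ x))
    then C x y * (u y - u x) ^ 2 else 0

/-- The `ℓ`-conductivity `σ_ℓ(G, C)`: the infimum of the Dirichlet sum over all
`u : V ∩ S_ℓ → [0,1]` with `u ≡ 1` on `V ∩ S_ℓ⁻` and `u ≡ 0` on `V ∩ S_ℓ⁺`. -/
noncomputable def sigmaCond (d : ℕ) (ℓ : ℝ) (V : Finset (EuclideanSpace ℝ (Fin d)))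
    (Adj : EuclideanSpace ℝ (Fin d) → EuclideanSpace ℝ (Fin d) → Prop)
    (C : EuclideanSpace ℝ (Fin d) → EuclideanSpace ℝ (Fin d) → ℝ) : ℝ :=
  sInf { r : ℝ | ∃ u : EuclideanSpace ℝ (Fin d) → ℝ,
    (∀ x ∈ V, inStripe d ℓ x → u x ∈ Set.Icc (0 : ℝ) 1) ∧
    (∀ x ∈ V, inLeft d ℓ x → u x = 1) ∧
    (∀ x ∈ V, inRight d ℓ x → u x = 0) ∧
    r = dirichletSum d ℓ V Adj C u }

/-- `π` is a left-right crossing of `Λ_ℓ` in the graph `(V, Adj)`: a sequence of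
distinct vertices of `V`, consecutive ones adjacent, starting in `S_ℓ⁻`, ending in
`S_ℓ⁺`, with all intermediate vertices (at least one) in `Λ_ℓ`. -/
def IsLRCrossing (d : ℕ) (ℓ : ℝ) (V : Finset (EuclideanSpace ℝ (Fin d)))
    (Adj : EuclideanSpace ℝ (Fin d) → EuclideanSpace ℝ (Fin d) → Prop)
    (π : List (EuclideanSpace ℝ (Fin d))) : Prop :=
  (∀ x ∈ π, x ∈ V) ∧ π.Nodup ∧ π.Chain' Adj ∧
  ∃ a mid b, π = a :: (mid ++ [b]) ∧ mid ≠ [] ∧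
    inLeft d ℓ a ∧ inRight d ℓ b ∧ ∀ x ∈ mid, inBox d ℓ x

/-- The pairs of consecutive vertices of disjoint self-avoiding paths, in both orientations, are
distinct ordered pairs, so a symmetric nonnegative function summed along the paths is at most
half of its full double sum. -/
theorem sum_disjoint_paths_le {α : Type*} (V : Finset α) (g : α → α → ℝ)
    (hsymm : ∀ x y, g x y = g y x) (hnonneg : ∀ x y, 0 ≤ g x y)
    {n : ℕ} (m : Fin n → ℕ) (p : Fin n → ℕ → α)
    (hV : ∀ i, ∀ k ≤ m i + 1, p i k ∈ V)
    (hinj : ∀ i j, ∀ k ≤ m i + 1, ∀ l ≤ m j + 1, p i k = p j l → i = j ∧ k = l) :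
    ∑ i, ∑ k ∈ Finset.range (m i + 1), g (p i k) (p i (k + 1)) ≤
      (1 / 2) * ∑ x ∈ V, ∑ y ∈ V, g x y := by
  let S : Finset (Σ _ : Fin n, ℕ) := Finset.univ.sigma fun i => Finset.range (m i + 1)
  let e : (Σ _ : Fin n, ℕ) → α × α := fun s => (p s.1 s.2, p s.1 (s.2 + 1))
  let e' : (Σ _ : Fin n, ℕ) → α × α := fun s => (p s.1 (s.2 + 1), p s.1 s.2)
  have hS : ∀ s ∈ S, s.2 < m s.1 + 1 := by
    intro s hs
    simpa [S] using hs
  have inj_of : ∀ s ∈ S, ∀ t ∈ S, p s.1 s.2 = p t.1 t.2 → s = t := by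
    rintro ⟨i, k⟩ hs ⟨j, l⟩ ht h
    have hk : k < m i + 1 := hS _ hs
    have hl : l < m j + 1 := hS _ ht
    obtain ⟨rfl, rfl⟩ := hinj i j k (by omega) l (by omega) h
    rfl
  have he : Set.InjOn e S := fun s hs t ht h => inj_of s hs t ht (Prod.ext_iff.1 h).1
  have he' : Set.InjOn e' S := fun s hs t ht h => inj_of s hs t ht (Prod.ext_iff.1 h).2
  have hdisj : Disjoint (S.image e) (S.image e') := by
    rw [Finset.disjoint_left]
    intro z hz hz'
    obtain ⟨⟨i, k⟩, hs, rfl⟩ := Finset.mem_image.1 hz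
    obtain ⟨⟨j, l⟩, ht, h⟩ := Finset.mem_image.1 hz'
    have hk := hS _ hs
    have hl := hS _ ht
    obtain ⟨h1, h2⟩ := Prod.ext_iff.1 h
    have a1 := (hinj j i (l + 1) (by simpa using hl) k (by simpa using hk.le) h1).2
    have a2 := (hinj j i l (by simpa using hl.le) (k + 1) (by simpa using hk) h2).2
    omega
  have hsub : S.image e ∪ S.image e' ⊆ V ×ˢ V := by
    intro z hz
    rcases Finset.mem_union.1 hz with hz | hz <;>
      obtain ⟨⟨i, k⟩, hs, rfl⟩ := Finset.mem_image.1 hz <;>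
      have hk := hS _ hs <;>
      simp only [e, e', Finset.mem_product] <;>
      first
      | exact ⟨hV _ _ hk.le, hV _ _ hk⟩
      | exact ⟨hV _ _ hk, hV _ _ hk.le⟩
  have key := Finset.sum_le_sum_of_subset_of_nonneg (f := fun z : α × α => g z.1 z.2) hsub
    (fun z _ _ => hnonneg _ _)
  rw [Finset.sum_union hdisj, Finset.sum_image he, Finset.sum_image he', Finset.sum_product] at key
  have hsw : ∑ s ∈ S, g (e' s).1 (e' s).2 = ∑ s ∈ S, g (e s).1 (e s).2 :=
    Finset.sum_congr rfl fun s _ => hsymm _ _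
  have hsig : ∑ s ∈ S, g (e s).1 (e s).2 =
      ∑ i, ∑ k ∈ Finset.range (m i + 1), g (p i k) (p i (k + 1)) := by
    simp only [S, e, Finset.sum_sigma]
  rw [hsw, hsig] at key
  linarith

/-- Cauchy–Schwarz for `n` functions, the `i`-th of which drops from `1` to `0` in `m i + 1`
steps. -/
theorem sq_le_mul_sum_sq_of_unit_drop {n : ℕ} (m : Fin n → ℕ) (f : Fin n → ℕ → ℝ)
    (h1 : ∀ i, f i 0 = 1) (h0 : ∀ i, f i (m i + 1) = 0) :
    (n : ℝ) ^ 2 ≤ (n + ∑ i, m i : ℕ) *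
      ∑ i, ∑ k ∈ Finset.range (m i + 1), (f i (k + 1) - f i k) ^ 2 := by
  have htele : ∑ i, ∑ k ∈ Finset.range (m i + 1), (f i (k + 1) - f i k) = -(n : ℝ) := by
    simp only [Finset.sum_range_sub, h0, h1]
    simp
  have hcard : (Finset.univ.sigma fun i => Finset.range (m i + 1)).card = n + ∑ i, m i := by
    simp [Finset.card_sigma, Finset.sum_add_distrib, add_comm]
  have hcs := sq_sum_le_card_mul_sum_sq
    (s := Finset.univ.sigma fun i => Finset.range (m i + 1))
    (f := fun s => f s.1 (s.2 + 1) - f s.1 s.2)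
  rw [Finset.sum_sigma, Finset.sum_sigma, htele, hcard, neg_sq] at hcs
  exact hcs

theorem inStripe_of_inBox {d : ℕ} {ℓ : ℝ} {x : EuclideanSpace ℝ (Fin d)} (h : inBox d ℓ x) :
    inStripe d ℓ x :=
  fun i _ => h i

theorem not_inRight_of_inLeft {d : ℕ} (hd : 1 ≤ d) {ℓ : ℝ} (hℓ : 0 < ℓ)
    {x : EuclideanSpace ℝ (Fin d)} (h : inLeft d ℓ x) : ¬ inRight d ℓ x := by
  intro h'
  have h1 := h.2 ⟨0, hd⟩ rfl
  have h2 := h'.2 ⟨0, hd⟩ rfl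
  linarith

/-- A left-right crossing with `m` interior vertices, as a function of the position along it. -/
theorem IsLRCrossing.exists_enumeration {d : ℕ} {ℓ : ℝ} {V : Finset (EuclideanSpace ℝ (Fin d))}
    {Adj : EuclideanSpace ℝ (Fin d) → EuclideanSpace ℝ (Fin d) → Prop}
    {π : List (EuclideanSpace ℝ (Fin d))} (h : IsLRCrossing d ℓ V Adj π) :
    ∃ (m : ℕ) (p : ℕ → EuclideanSpace ℝ (Fin d)), 1 ≤ m ∧
      (∀ k ≤ m + 1, p k ∈ π) ∧ (∀ k ≤ m + 1, p k ∈ V) ∧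
      (∀ k ≤ m + 1, ∀ l ≤ m + 1, p k = p l → k = l) ∧
      (∀ k ≤ m, Adj (p k) (p (k + 1))) ∧
      inLeft d ℓ (p 0) ∧ inRight d ℓ (p (m + 1)) ∧ ∀ k < m, inBox d ℓ (p (k + 1)) := by
  obtain ⟨hV, hnodup, hchain, a, mid, b, rfl, hmid, ha, hb, hbox⟩ := h
  have hlen : (a :: (mid ++ [b])).length = mid.length + 2 := by simp
  have hget : ∀ k (hk : k ≤ mid.length + 1), (a :: (mid ++ [b])).getD k 0 =
      (a :: (mid ++ [b]))[k]'(by omega) := fun k hk =>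
    List.getD_eq_getElem _ _ (by omega)
  have hmem : ∀ k ≤ mid.length + 1, (a :: (mid ++ [b])).getD k 0 ∈ a :: (mid ++ [b]) := by
    intro k hk
    rw [hget k hk]
    exact List.getElem_mem _
  refine ⟨mid.length, fun k => (a :: (mid ++ [b])).getD k 0, List.length_pos_iff.2 hmid, hmem,
    fun k hk => hV _ (hmem k hk), ?_, ?_, by simpa using ha, by simpa using hb, ?_⟩
  · intro k hk l hl hkl
    simp only [hget k hk, hget l hl] at hkl
    exact (hnodup.getElem_inj_iff).1 hkl
  · intro k hk
    simp only [hget k (by omega), hget (k + 1) (by omega)]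
    exact List.isChain_iff_getElem.1 hchain k (by omega)
  · intro k hk
    have : (a :: (mid ++ [b])).getD (k + 1) 0 = mid[k] := by
      simp [List.getElem?_append, hk]
    simp only [this]
    exact hbox _ (List.getElem_mem _)

/-- Lemma 10.1 (lemma_LB_chiave): if there are `n` pairwise vertex-disjoint LR
crossings of `Λ_ℓ` in the graph `G = (V, Adj)`, then
`σ_ℓ(G,1) ≥ n²/(2n + |V ∩ Λ_ℓ|) ≥ n²/(3 |V ∩ Λ_ℓ|)`. -/
theorem conductivity_lower_bound_LR (d : ℕ) (hd : 1 ≤ d) (ℓ : ℝ) (hℓ : 0 < ℓ)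
    (V : Finset (EuclideanSpace ℝ (Fin d)))
    (Adj : EuclideanSpace ℝ (Fin d) → EuclideanSpace ℝ (Fin d) → Prop)
    (hAdjSymm : ∀ x y, Adj x y → Adj y x)
    (n : ℕ) (π : Fin n → List (EuclideanSpace ℝ (Fin d)))
    (hcross : ∀ i, IsLRCrossing d ℓ V Adj (π i))
    (hdisj : ∀ i j, i ≠ j → List.Disjoint (π i) (π j)) :
    sigmaCond d ℓ V Adj (fun _ _ => 1) ≥
        (n : ℝ) ^ 2 / (2 * n + (V.filter (fun x => inBox d ℓ x)).card) ∧
    (n : ℝ) ^ 2 / (2 * n + (V.filter (fun x => inBox d ℓ x)).card) ≥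
        (n : ℝ) ^ 2 / (3 * (V.filter (fun x => inBox d ℓ x)).card) := by
  choose m p hm hmem hV hinj hadj hleft hright hbox using
    fun i => (hcross i).exists_enumeration
  have hinj' : ∀ i j, ∀ k ≤ m i + 1, ∀ l ≤ m j + 1, p i k = p j l → i = j ∧ k = l := by
    intro i j k hk l hl h
    by_cases hij : i = j
    · subst hij
      exact ⟨rfl, hinj i k hk l hl h⟩
    · exact absurd (h ▸ hmem j l hl) (hdisj i j hij (hmem i k hk))
  set N := (V.filter (fun x => inBox d ℓ x)).card
  have hsum : ∑ i, m i ≤ N := by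
    have : (Finset.univ.sigma fun i => Finset.range (m i)).card ≤ N := by
      refine Finset.card_le_card_of_injOn (fun s => p s.1 (s.2 + 1)) ?_ ?_
      · rintro ⟨i, k⟩ hs
        have hk : k < m i := by simpa using hs
        simpa using ⟨hV i (k + 1) (by omega), hbox i k hk⟩
      · rintro ⟨i, k⟩ hs ⟨j, l⟩ ht h
        have hk : k < m i := by simpa using hs
        have hl : l < m j := by simpa using ht
        obtain ⟨rfl, hkl⟩ := hinj' i j (k + 1) (by omega) (l + 1) (by omega) h
        obtain rfl : k = l := by omega
        rfl
    simpa using this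
  have hnN : n ≤ N := by
    refine le_trans ?_ hsum
    simpa using Finset.card_nsmul_le_sum Finset.univ m 1 fun i _ => hm i
  have hnN' : (n : ℝ) ≤ N := Nat.cast_le.2 hnN
  clear_value N
  constructor
  · refine le_csInf ?_ ?_
    · refine ⟨_, fun x => if inLeft d ℓ x then 1 else 0, ?_, ?_, ?_, rfl⟩
      · intro x _ _
        change (if inLeft d ℓ x then (1 : ℝ) else 0) ∈ Set.Icc (0 : ℝ) 1
        split_ifs <;> simp
      · intro x _ hx
        simp [hx]
      · intro x _ hx
        have : ¬ inLeft d ℓ x := fun h => not_inRight_of_inLeft hd hℓ h hx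
        simp [this]
    · rintro r ⟨u, -, hu1, hu0, rfl⟩
      have hpath := sum_disjoint_paths_le V
        (fun x y => if x ≠ y ∧ Adj x y ∧
          ((inBox d ℓ x ∧ inStripe d ℓ y) ∨ (inBox d ℓ y ∧ inStripe d ℓ x))
          then (1 : ℝ) * (u y - u x) ^ 2 else 0)
        (by
          intro x y
          have hxy : Adj x y ↔ Adj y x := ⟨hAdjSymm x y, hAdjSymm y x⟩
          have hsq : (u y - u x) ^ 2 = (u x - u y) ^ 2 := by ring
          simp only [hxy, hsq, ne_comm (a := x), or_comm (a := inBox d ℓ x ∧ inStripe d ℓ y)])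
        (by
          intro x y
          split_ifs <;> positivity)
        m p hV hinj'
      have henergy : ∑ i, ∑ k ∈ Finset.range (m i + 1), (u (p i (k + 1)) - u (p i k)) ^ 2 ≤
          dirichletSum d ℓ V Adj (fun _ _ => 1) u := by
        refine le_trans (le_of_eq ?_) hpath
        refine Finset.sum_congr rfl fun i _ => Finset.sum_congr rfl fun k hk => ?_
        have hk' : k < m i + 1 := Finset.mem_range.1 hk
        have hne : p i k ≠ p i (k + 1) := fun h => by
          have := hinj i k (by omega) (k + 1) (by omega) h
          omega
        have hedge : (inBox d ℓ (p i k) ∧ inStripe d ℓ (p i (k + 1))) ∨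
            (inBox d ℓ (p i (k + 1)) ∧ inStripe d ℓ (p i k)) := by
          rcases k with _ | k
          · exact Or.inr ⟨hbox i 0 (hm i), (hleft i).1⟩
          · refine Or.inl ⟨hbox i k (by omega), ?_⟩
            rcases Nat.lt_or_ge (k + 1) (m i) with hlt | hge
            · exact inStripe_of_inBox (hbox i (k + 1) hlt)
            · have hEq : k + 1 = m i := by omega
              rw [hEq]
              exact (hright i).1
        rw [if_pos ⟨hne, hadj i k (by omega), hedge⟩, one_mul]
      have hcs := sq_le_mul_sum_sq_of_unit_drop m (fun i k => u (p i k))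
        (fun i => hu1 _ (hV i 0 (by omega)) (hleft i))
        (fun i => hu0 _ (hV i _ le_rfl) (hright i))
      have hsteps : ((n + ∑ i, m i : ℕ) : ℝ) ≤ 2 * n + N := by
        exact_mod_cast (by omega : n + ∑ i, m i ≤ 2 * n + N)
      have hE : (0 : ℝ) ≤ ∑ i, ∑ k ∈ Finset.range (m i + 1), (u (p i (k + 1)) - u (p i k)) ^ 2 :=
        Finset.sum_nonneg fun i _ => Finset.sum_nonneg fun k _ => sq_nonneg _
      refine div_le_of_le_mul₀ (by positivity) (hE.trans henergy) ?_
      calc (n : ℝ) ^ 2 ≤ _ := hcs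
        _ ≤ (2 * n + N) *
            ∑ i, ∑ k ∈ Finset.range (m i + 1), (u (p i (k + 1)) - u (p i k)) ^ 2 :=
          mul_le_mul_of_nonneg_right hsteps hE
        _ ≤ (2 * n + N) * dirichletSum d ℓ V Adj (fun _ _ => 1) u :=
          mul_le_mul_of_nonneg_left henergy (by positivity)
        _ = _ := mul_comm _ _
  · rcases Nat.eq_zero_or_pos n with rfl | hn
    · simp
    · have : (0 : ℝ) < n := Nat.cast_pos.2 hn
      exact div_le_div_of_nonneg_left (by positivity) (by positivity) (by linarith)
end
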